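/- The inequality −3J + 2α₁ ≤ U_β(c,n₁,n₂,n₃) holds for all β ∈ {α₁, α₂} and all c, n₁, n₂, n₃ ∈ {0,1,2} if and only if J ≥ 0, α₁ ≤ 0 and α₂ ≥ α₁. (That is, the value U₁₅ = −3J + 2α₁ is the minimal possible unit-ball energy exactly on the set A₁₅ = {(J,α₁,α₂) : J ≥ 0, α₁ ≤ 0, α₂ ≥ α₁}.) -/

import Mathlib

/-- Unit-ball energy of the SOS model on the Cayley tree of order 2 with spin values
`{0,1,2}`, coupling `J`, where the center of the ball carries the external field
value `β`: for center spin `c` and neighbor spins `n₁, n₂, n₃`,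
`U_β(c,n₁,n₂,n₃) = -(J/2)·(|c−n₁| + |c−n₂| + |c−n₃|) + β·c`. -/
noncomputable def ballEnergy (J β : ℝ) (c n₁ n₂ n₃ : Fin 3) : ℝ :=
  -(J / 2) * (|((c : ℕ) : ℝ) - ((n₁ : ℕ) : ℝ)| + |((c : ℕ) : ℝ) - ((n₂ : ℕ) : ℝ)|
      + |((c : ℕ) : ℝ) - ((n₃ : ℕ) : ℝ)|)
    + β * ((c : ℕ) : ℝ)

/-- Two spins in `{0,1,2}` differ by at most `2`. -/
lemma abs_spin_sub_le_two (a b : Fin 3) : |((a : ℕ) : ℝ) - ((b : ℕ) : ℝ)| ≤ 2 := by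
  have ha : ((a : ℕ) : ℝ) ≤ 2 := by exact_mod_cast a.is_le
  have hb : ((b : ℕ) : ℝ) ≤ 2 := by exact_mod_cast b.is_le
  have ha' : (0 : ℝ) ≤ ((a : ℕ) : ℝ) := Nat.cast_nonneg _
  have hb' : (0 : ℝ) ≤ ((b : ℕ) : ℝ) := Nat.cast_nonneg _
  exact abs_le.mpr ⟨by linarith, by linarith⟩

/-- For nonnegative coupling, each of the three edges contributes at least `-J`. -/
lemma neg_three_mul_add_le_ballEnergy {J : ℝ} (hJ : 0 ≤ J) (β : ℝ) (c n₁ n₂ n₃ : Fin 3) :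
    -3 * J + β * ((c : ℕ) : ℝ) ≤ ballEnergy J β c n₁ n₂ n₃ := by
  unfold ballEnergy
  have h₁ := mul_le_mul_of_nonneg_left (abs_spin_sub_le_two c n₁) hJ
  have h₂ := mul_le_mul_of_nonneg_left (abs_spin_sub_le_two c n₂) hJ
  have h₃ := mul_le_mul_of_nonneg_left (abs_spin_sub_le_two c n₃) hJ
  linarith

/-- `U₁₅ = −3J + 2α₁` is the minimal unit-ball energy exactly when `J ≥ 0`,
`α₁ ≤ 0` and `α₂ ≥ α₁`. -/
theorem neg_three_J_add_two_alpha_one_min_iff (J α₁ α₂ : ℝ) :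
    (∀ β ∈ ({α₁, α₂} : Set ℝ), ∀ c n₁ n₂ n₃ : Fin 3,
        -3*J + 2*α₁ ≤ ballEnergy J β c n₁ n₂ n₃) ↔
      (0 ≤ J ∧ α₁ ≤ 0 ∧ α₁ ≤ α₂) := by
  constructor
  · intro h
    have h₁ := h α₁ (by simp) 2 2 2 2
    have h₂ := h α₁ (by simp) 0 2 2 2
    have h₃ := h α₂ (by simp) 2 0 0 0
    norm_num [ballEnergy] at h₁ h₂ h₃
    exact ⟨by linarith, by linarith, by linarith⟩
  · rintro ⟨hJ, hα₁, hα₂⟩ β hβ c n₁ n₂ n₃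
    have hβ' : α₁ ≤ β := by
      rcases hβ with rfl | rfl
      · exact le_rfl
      · exact hα₂
    have hc : ((c : ℕ) : ℝ) ≤ 2 := by exact_mod_cast c.is_le
    have h₁ := mul_le_mul_of_nonpos_left hc hα₁
    have h₂ := mul_le_mul_of_nonneg_right hβ' (Nat.cast_nonneg (α := ℝ) (c : ℕ))
    linarith [neg_three_mul_add_le_ballEnergy hJ β c n₁ n₂ n₃]
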